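/- Consider a graphon game with graphon W and noise b satisfying Assumptions (G3) and (G4) with constant c_W>0, and let α̂∈𝒜^∞ be its unique Nash equilibrium. Consider a second graphon game with graphon W′ and noise b′ (same kernels Ã,B̃,C̃, constant λ, common noise b* and filtration), and assume it admits a Nash equilibrium β̂∈𝒜^∞. Then 𝔼[∫₀¹∫₀^T(α̂^u_t−β̂^u_t)²dt du] ≤ (1/(2c_W))·‖𝐁̃‖_op·‖𝐖−𝐖′‖_op·(𝔼[∫₀¹∫₀^T(α̂^u_t)²dt du] + 3𝔼[∫₀¹∫₀^T(β̂^u_t)²dt du]) + (1/(2c_W))·(𝔼[∫₀¹∫₀^T(b^u_t−b′^u_t)²dt du])^{1/2}·((𝔼[∫₀¹∫₀^T(α̂^u_t)²dt du])^{1/2} + (𝔼[∫₀¹∫₀^T(β̂^u_t)²dt du])^{1/2}), where ‖𝐁̃‖_op is the operator norm of 𝐁̃ on L²([0,T],ℝ) and ‖𝐖−𝐖′‖_op the operator norm of 𝐖−𝐖′ on L²([0,1],ℝ). -/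

import Mathlib

open MeasureTheory Set Filter

noncomputable section

/-- Inner product on `L²([0,T],ℝ)`. -/
def ip (T : ℝ) (f g : ℝ → ℝ) : ℝ := ∫ t in Icc (0:ℝ) T, f t * g t

/-- Integral operator induced by a kernel `G`. -/
def opK (T : ℝ) (G : ℝ → ℝ → ℝ) (f : ℝ → ℝ) : ℝ → ℝ :=
  fun t => ∫ s in Icc (0:ℝ) T, G t s * f s

/-- Integral operator induced by the adjoint kernel `G*(t,s) = G(s,t)`. -/
def opKadj (T : ℝ) (G : ℝ → ℝ → ℝ) (f : ℝ → ℝ) : ℝ → ℝ :=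
  fun t => ∫ s in Icc (0:ℝ) T, G s t * f s

/-- `G ∈ L²([0,T]²,ℝ)`. -/
def IsL2Kernel (T : ℝ) (G : ℝ → ℝ → ℝ) : Prop :=
  Measurable (Function.uncurry G) ∧
    Integrable (fun p : ℝ × ℝ => (G p.1 p.2) ^ 2)
      ((volume.restrict (Icc (0:ℝ) T)).prod (volume.restrict (Icc (0:ℝ) T)))

/-- Volterra kernel in `𝒢`: square integrable on `[0,T]²` and vanishing for `s ≥ t`. -/
def IsVolterraKernel (T : ℝ) (G : ℝ → ℝ → ℝ) : Prop :=
  IsL2Kernel T G ∧ ∀ t s : ℝ, t ≤ s → G t s = 0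

/-- Membership in `L²([0,T],ℝ)`. -/
def MemL2 (T : ℝ) (f : ℝ → ℝ) : Prop :=
  Measurable f ∧ Integrable (fun t => (f t) ^ 2) (volume.restrict (Icc (0:ℝ) T))

/-- Membership in `L²([0,T],ℝ^N)`. -/
def MemL2N (T : ℝ) {N : ℕ} (f : ℝ → Fin N → ℝ) : Prop :=
  (∀ i, Measurable fun t => f t i) ∧
    Integrable (fun t => ∑ i, (f t i) ^ 2) (volume.restrict (Icc (0:ℝ) T))

variable {Ω : Type}

/-- Square-integrability of a process on `[0,T] × Ω`. -/
def SqInt (T : ℝ) [MeasurableSpace Ω] (P : Measure Ω) (α : ℝ → Ω → ℝ) : Prop :=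
  Integrable (fun p : ℝ × Ω => (α p.1 p.2) ^ 2) ((volume.restrict (Icc (0:ℝ) T)).prod P)

/-- Admissible control: progressively measurable and square integrable on `[0,T] × Ω`. -/
def Admissible (T : ℝ) {mΩ : MeasurableSpace Ω} (F : Filtration ℝ mΩ) (P : Measure Ω)
    (α : ℝ → Ω → ℝ) : Prop :=
  ProgMeasurable F α ∧ SqInt T P α

/-- A graphon: Borel-measurable, symmetric, `[0,1]`-valued. -/
def IsGraphon (W : ℝ → ℝ → ℝ) : Prop :=
  Measurable (Function.uncurry W) ∧ (∀ u v, W u v = W v u) ∧ ∀ u v, W u v ∈ Icc (0:ℝ) 1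

/-- Membership in `L²([0,T]×[0,1],ℝ)` (first variable: time, second variable: label). -/
def MemL2TI (T : ℝ) (g : ℝ → ℝ → ℝ) : Prop :=
  Measurable (Function.uncurry g) ∧
    Integrable (fun p : ℝ × ℝ => (g p.1 p.2) ^ 2)
      ((volume.restrict (Icc (0:ℝ) T)).prod (volume.restrict (Icc (0:ℝ) 1)))

/-- Objective functional `J^{u,W}` of player `u` in the graphon game. -/
def Jgr (T : ℝ) {mΩ : MeasurableSpace Ω} (P : Measure Ω)
    (Atil Btil Ctil : ℝ → ℝ → ℝ) (lam : ℝ) (W : ℝ → ℝ → ℝ)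
    (b : ℝ → ℝ → Ω → ℝ) (bstar : ℝ → Ω → ℝ) (c : ℝ → Ω → ℝ)
    (u : ℝ) (α : ℝ → ℝ → Ω → ℝ) : ℝ :=
  ∫ ω,
    (- ip T (fun t => α u t ω)
        (fun t => opK T Atil (fun s => α u s ω) t + lam * α u t ω)
      - ip T (fun t => α u t ω)
          (fun t => opK T Btil (fun s => ∫ v in Icc (0:ℝ) 1, W u v * α v s ω) t
            + opKadj T Btil (fun s => ∫ v in Icc (0:ℝ) 1, W u v * α v s ω) t)
      - ip T (fun t => ∫ v in Icc (0:ℝ) 1, W u v * α v t ω)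
          (opK T Ctil (fun s => ∫ v in Icc (0:ℝ) 1, W u v * α v s ω))
      + ip T (fun t => b u t ω) (fun t => α u t ω)
      + ip T (fun t => bstar t ω) (fun t => ∫ v in Icc (0:ℝ) 1, W u v * α v t ω)
      + c u ω) ∂P

/-- Admissible strategy profile of the graphon game. -/
def AdmProfile (T : ℝ) {mΩ : MeasurableSpace Ω} (F : Filtration ℝ mΩ) (P : Measure Ω)
    (α : ℝ → ℝ → Ω → ℝ) : Prop :=
  Measurable (fun q : ℝ × ℝ × Ω => α q.1 q.2.1 q.2.2) ∧
    (∀ u ∈ Icc (0:ℝ) 1, ProgMeasurable F (α u)) ∧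
    (∀ᵐ u ∂(volume.restrict (Icc (0:ℝ) 1)), SqInt T P (α u)) ∧
    Integrable (fun q : ℝ × ℝ × Ω => (α q.1 q.2.1 q.2.2) ^ 2)
      ((volume.restrict (Icc (0:ℝ) 1)).prod ((volume.restrict (Icc (0:ℝ) T)).prod P))

/-- Graphon game Nash equilibrium: for a.e. label `u`, the control `α u` maximizes
the objective of player `u` among all admissible deviations. -/
def IsGraphonNash (T : ℝ) {mΩ : MeasurableSpace Ω} (F : Filtration ℝ mΩ) (P : Measure Ω)
    (Atil Btil Ctil : ℝ → ℝ → ℝ) (lam : ℝ) (W : ℝ → ℝ → ℝ)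
    (b : ℝ → ℝ → Ω → ℝ) (bstar : ℝ → Ω → ℝ) (c : ℝ → Ω → ℝ)
    (α : ℝ → ℝ → Ω → ℝ) : Prop :=
  AdmProfile T F P α ∧
    ∀ᵐ u ∂(volume.restrict (Icc (0:ℝ) 1)),
      ∀ β : ℝ → Ω → ℝ, ProgMeasurable F β → SqInt T P β →
        Jgr T P Atil Btil Ctil lam W b bstar c u (Function.update α u β)
          ≤ Jgr T P Atil Btil Ctil lam W b bstar c u α

/-- Operator norm of the integral operator induced by `G` on `L²([0,T],ℝ)`. -/
def timeOpNorm (T : ℝ) (G : ℝ → ℝ → ℝ) : ℝ :=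
  sInf {x : ℝ | 0 ≤ x ∧ ∀ f : ℝ → ℝ, MemL2 T f →
    (∫ t in Icc (0:ℝ) T, (opK T G f t) ^ 2) ≤ x ^ 2 * ∫ t in Icc (0:ℝ) T, (f t) ^ 2}

/-- Operator norm on `L²([0,1],ℝ)` of the integral operator induced by the kernel `U`. -/
def labelOpNorm (U : ℝ → ℝ → ℝ) : ℝ :=
  sInf {x : ℝ | 0 ≤ x ∧ ∀ g : ℝ → ℝ, MemL2 1 g →
    (∫ u in Icc (0:ℝ) 1, (∫ v in Icc (0:ℝ) 1, U u v * g v) ^ 2)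
      ≤ x ^ 2 * ∫ u in Icc (0:ℝ) 1, (g u) ^ 2}


/-! ### Square integrable measurable functions -/

/-- Measurable and square integrable. -/
def SqL {X : Type} [MeasurableSpace X] (ν : Measure X) (f : X → ℝ) : Prop :=
  Measurable f ∧ Integrable (fun x => (f x) ^ 2) ν

/-- Lebesgue measure on `[0,T]`. -/
abbrev mT (T : ℝ) : Measure ℝ := volume.restrict (Icc (0:ℝ) T)

section SqLlemmas

variable {X : Type} [MeasurableSpace X] {ν : Measure X}

theorem SqL.memLp {f : X → ℝ} (hf : SqL ν f) : MemLp f 2 ν :=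
  (memLp_two_iff_integrable_sq hf.1.aestronglyMeasurable).2 hf.2

theorem SqL.of_memLp {f : X → ℝ} (h1 : Measurable f) (hf : MemLp f 2 ν) : SqL ν f :=
  ⟨h1, (memLp_two_iff_integrable_sq h1.aestronglyMeasurable).1 hf⟩

theorem SqL.mul {f g : X → ℝ} (hf : SqL ν f) (hg : SqL ν g) :
    Integrable (fun x => f x * g x) ν := hf.memLp.integrable_mul hg.memLp

theorem SqL.add {f g : X → ℝ} (hf : SqL ν f) (hg : SqL ν g) :
    SqL ν (fun x => f x + g x) :=
  SqL.of_memLp (hf.1.add hg.1) (hf.memLp.add hg.memLp)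

theorem SqL.sub {f g : X → ℝ} (hf : SqL ν f) (hg : SqL ν g) :
    SqL ν (fun x => f x - g x) :=
  SqL.of_memLp (hf.1.sub hg.1) (hf.memLp.sub hg.memLp)

theorem SqL.smul {f : X → ℝ} (hf : SqL ν f) (c : ℝ) :
    SqL ν (fun x => c * f x) :=
  SqL.of_memLp (hf.1.const_mul c) (hf.memLp.const_mul c)

theorem sq_nn (f : X → ℝ) : 0 ≤ ∫ x, (f x) ^ 2 ∂ν := integral_nonneg fun _ => sq_nonneg _

/-- Cauchy-Schwarz, squared. -/
theorem SqL.cs {f g : X → ℝ} (hf : SqL ν f) (hg : SqL ν g) :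
    (∫ x, f x * g x ∂ν) ^ 2 ≤ (∫ x, (f x) ^ 2 ∂ν) * ∫ x, (g x) ^ 2 ∂ν := by
  have key : ∀ c : ℝ, 0 ≤ (∫ x, (g x) ^ 2 ∂ν) * (c * c) + (2 * ∫ x, f x * g x ∂ν) * c
      + ∫ x, (f x) ^ 2 ∂ν := by
    intro c
    have h0 := sq_nn (ν := ν) (fun x => f x + c * g x)
    have : ∫ x, (f x + c * g x) ^ 2 ∂ν = (∫ x, (g x) ^ 2 ∂ν) * (c * c)
        + (2 * ∫ x, f x * g x ∂ν) * c + ∫ x, (f x) ^ 2 ∂ν := by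
      have e : (fun x => (f x + c * g x) ^ 2)
          = fun x => ((c * c) * (g x) ^ 2 + (2 * c) * (f x * g x)) + (f x) ^ 2 := by
        funext x; ring
      have i1 : Integrable (fun x => (c * c) * (g x) ^ 2 + (2 * c) * (f x * g x)) ν :=
        (hg.2.const_mul _).add ((hf.mul hg).const_mul _)
      rw [e, integral_add i1 hf.2,
        integral_add (hg.2.const_mul _) ((hf.mul hg).const_mul _), integral_const_mul,
        integral_const_mul]
      ring
    linarith
  have := discrim_le_zero key
  unfold discrim at this
  nlinarith

theorem SqL.cs_sqrt {f g : X → ℝ} (hf : SqL ν f) (hg : SqL ν g) :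
    |∫ x, f x * g x ∂ν| ≤ Real.sqrt (∫ x, (f x) ^ 2 ∂ν) * Real.sqrt (∫ x, (g x) ^ 2 ∂ν) := by
  rw [← Real.sqrt_mul (sq_nn f), ← Real.sqrt_sq_eq_abs]
  exact Real.sqrt_le_sqrt (hf.cs hg)

theorem SqL.minkowski {f g : X → ℝ} (hf : SqL ν f) (hg : SqL ν g) :
    Real.sqrt (∫ x, (f x - g x) ^ 2 ∂ν) ≤
      Real.sqrt (∫ x, (f x) ^ 2 ∂ν) + Real.sqrt (∫ x, (g x) ^ 2 ∂ν) := by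
  apply Real.sqrt_le_iff.2
  refine ⟨by positivity, ?_⟩
  have e : (fun x => (f x - g x) ^ 2)
      = fun x => ((f x) ^ 2 - 2 * (f x * g x)) + (g x) ^ 2 := by
    funext x; ring
  have i1 : Integrable (fun x => (f x) ^ 2 - 2 * (f x * g x)) ν :=
    hf.2.sub ((hf.mul hg).const_mul _)
  rw [e, integral_add i1 hg.2,
    integral_sub hf.2 ((hf.mul hg).const_mul _), integral_const_mul]
  have h1 := (abs_le.1 (hf.cs_sqrt hg)).1
  have h2 := Real.sq_sqrt (sq_nn (ν := ν) f)
  have h3 := Real.sq_sqrt (sq_nn (ν := ν) g)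
  nlinarith

end SqLlemmas

section Sections

variable {X Y Z : Type} [MeasurableSpace X] [MeasurableSpace Y] [MeasurableSpace Z]
  {ν : Measure X} {κ : Measure Y} [SFinite ν] [SFinite κ]

theorem SqL.swap {f : X × Y → ℝ} (hf : SqL (ν.prod κ) f) :
    SqL (κ.prod ν) (fun p => f (p.2, p.1)) :=
  ⟨hf.1.comp measurable_swap, hf.2.swap⟩

theorem SqL.right {f : X × Y → ℝ} (hf : SqL (ν.prod κ) f) :
    ∀ᵐ x ∂ν, SqL κ (fun y => f (x, y)) := by
  filter_upwards [hf.2.prod_right_ae] with x hx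
  exact ⟨hf.1.comp measurable_prodMk_left, hx⟩

theorem meas_int {f : X → Y → ℝ} (hf : Measurable fun p : X × Y => f p.1 p.2) :
    Measurable fun x => ∫ y, f x y ∂κ :=
  (StronglyMeasurable.integral_prod_right (f := f) hf.stronglyMeasurable).measurable

end Sections

/-! ### Kernel operators on `[0,T]` -/

theorem MemL2.toSqL {T : ℝ} {f : ℝ → ℝ} (h : MemL2 T f) : SqL (mT T) f := h
theorem SqL.toMemL2 {T : ℝ} {f : ℝ → ℝ} (h : SqL (mT T) f) : MemL2 T f := h

theorem IsL2Kernel.toSqL {T : ℝ} {G : ℝ → ℝ → ℝ} (h : IsL2Kernel T G) :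
    SqL ((mT T).prod (mT T)) (fun p => G p.1 p.2) := h

theorem IsL2Kernel.flip {T : ℝ} {G : ℝ → ℝ → ℝ} (h : IsL2Kernel T G) :
    IsL2Kernel T (fun t s => G s t) := h.toSqL.swap

/-- Squared Hilbert-Schmidt norm. -/
def hs (T : ℝ) (G : ℝ → ℝ → ℝ) : ℝ := ∫ t in Icc (0:ℝ) T, ∫ s in Icc (0:ℝ) T, (G t s) ^ 2

theorem hs_nonneg (T : ℝ) (G : ℝ → ℝ → ℝ) : 0 ≤ hs T G :=
  integral_nonneg fun _ => sq_nn _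

theorem opK_meas {T : ℝ} {G : ℝ → ℝ → ℝ} (hG : IsL2Kernel T G) {f : ℝ → ℝ} (hf : Measurable f) :
    Measurable (opK T G f) := by
  unfold opK
  exact meas_int (f := fun t s => G t s * f s)
    (hG.1.mul (hf.comp measurable_snd))

theorem opK_ptwise {T : ℝ} {G : ℝ → ℝ → ℝ} (hG : IsL2Kernel T G) :
    ∀ᵐ t ∂(mT T), SqL (mT T) (G t) ∧ ∀ f, SqL (mT T) f →
      (opK T G f t) ^ 2 ≤ (∫ s in Icc (0:ℝ) T, (G t s) ^ 2) * ∫ s in Icc (0:ℝ) T, (f s) ^ 2 := by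
  filter_upwards [hG.toSqL.right] with t ht
  exact ⟨ht, fun f hf => ht.cs hf⟩

theorem opK_sqL {T : ℝ} {G : ℝ → ℝ → ℝ} (hG : IsL2Kernel T G) {f : ℝ → ℝ} (hf : SqL (mT T) f) :
    SqL (mT T) (opK T G f) := by
  refine ⟨opK_meas hG hf.1, ?_⟩
  have h1 : Integrable (fun t => (∫ s in Icc (0:ℝ) T, (G t s) ^ 2) *
      ∫ s in Icc (0:ℝ) T, (f s) ^ 2) (mT T) :=
    (hG.2.integral_prod_left).mul_const _
  refine h1.mono' ((opK_meas hG hf.1).pow_const 2).aestronglyMeasurable ?_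
  filter_upwards [opK_ptwise hG] with t ht
  rw [Real.norm_of_nonneg (sq_nonneg _)]
  exact ht.2 f hf

theorem opK_bound {T : ℝ} {G : ℝ → ℝ → ℝ} (hG : IsL2Kernel T G) {f : ℝ → ℝ}
    (hf : SqL (mT T) f) :
    ∫ t in Icc (0:ℝ) T, (opK T G f t) ^ 2 ≤ hs T G * ∫ s in Icc (0:ℝ) T, (f s) ^ 2 := by
  unfold hs
  rw [← integral_mul_const]
  refine integral_mono_ae (opK_sqL hG hf).2 ((hG.2.integral_prod_left).mul_const _) ?_
  filter_upwards [opK_ptwise hG] with t ht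
  exact ht.2 f hf

theorem opK_lin {T : ℝ} {G : ℝ → ℝ → ℝ} (hG : IsL2Kernel T G) {f g : ℝ → ℝ}
    (hf : SqL (mT T) f) (hg : SqL (mT T) g) (a : ℝ) :
    ∀ᵐ t ∂(mT T), opK T G (fun s => f s + a * g s) t = opK T G f t + a * opK T G g t := by
  filter_upwards [opK_ptwise hG] with t ht
  unfold opK
  rw [← integral_const_mul, ← integral_add (ht.1.mul hf) ((ht.1.mul hg).const_mul a)]
  congr 1; funext s; ring

/-- Bilinear form of a kernel. -/
def qf (T : ℝ) (G : ℝ → ℝ → ℝ) (f g : ℝ → ℝ) : ℝ := ip T f (opK T G g)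

theorem ip_comm (T : ℝ) (f g : ℝ → ℝ) : ip T f g = ip T g f := by
  unfold ip; congr 1; funext t; ring

theorem ip_lin_left {T : ℝ} {f g h : ℝ → ℝ}
    (hf : SqL (mT T) f) (hg : SqL (mT T) g) (hh : SqL (mT T) h) (a : ℝ) :
    ip T (fun s => f s + a * g s) h = ip T f h + a * ip T g h := by
  unfold ip
  rw [← integral_const_mul, ← integral_add (hf.mul hh) ((hg.mul hh).const_mul a)]
  congr 1; funext s; ring

theorem ip_lin_right {T : ℝ} {f g h : ℝ → ℝ}
    (hf : SqL (mT T) f) (hg : SqL (mT T) g) (hh : SqL (mT T) h) (a : ℝ) :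
    ip T h (fun s => f s + a * g s) = ip T h f + a * ip T h g := by
  rw [ip_comm, ip_lin_left hf hg hh, ip_comm T f, ip_comm T g]

theorem ip_congr_right {T : ℝ} {f g h : ℝ → ℝ} (hh : f =ᵐ[mT T] g) :
    ip T h f = ip T h g := by
  unfold ip
  apply integral_congr_ae
  filter_upwards [hh] with t ht
  rw [ht]

theorem ip_congr_left {T : ℝ} {f g h : ℝ → ℝ} (hh : f =ᵐ[mT T] g) :
    ip T f h = ip T g h := by
  rw [ip_comm, ip_congr_right hh, ip_comm]

theorem opK_congr {T : ℝ} {G : ℝ → ℝ → ℝ} {f g : ℝ → ℝ} (hh : f =ᵐ[mT T] g) :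
    opK T G f = opK T G g := by
  funext t
  unfold opK
  apply integral_congr_ae
  filter_upwards [hh] with t ht
  rw [ht]

theorem qf_lin_left {T : ℝ} {G : ℝ → ℝ → ℝ} (hG : IsL2Kernel T G) {f g h : ℝ → ℝ}
    (hf : SqL (mT T) f) (hg : SqL (mT T) g) (hh : SqL (mT T) h) (a : ℝ) :
    qf T G (fun s => f s + a * g s) h = qf T G f h + a * qf T G g h :=
  ip_lin_left hf hg (opK_sqL hG hh) a

theorem qf_lin_right {T : ℝ} {G : ℝ → ℝ → ℝ} (hG : IsL2Kernel T G) {f g h : ℝ → ℝ}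
    (hf : SqL (mT T) f) (hg : SqL (mT T) g) (hh : SqL (mT T) h) (a : ℝ) :
    qf T G h (fun s => f s + a * g s) = qf T G h f + a * qf T G h g := by
  unfold qf
  rw [ip_congr_right (opK_lin hG hf hg a)]
  exact ip_lin_right (opK_sqL hG hf) (opK_sqL hG hg) hh a

theorem ip_opKadj {T : ℝ} {G : ℝ → ℝ → ℝ} (hG : IsL2Kernel T G) {f g : ℝ → ℝ}
    (hf : SqL (mT T) f) (hg : SqL (mT T) g) :
    ip T f (opKadj T G g) = qf T G g f := by
  have hsq : SqL ((mT T).prod (mT T)) (fun p => f p.1 * g p.2) := by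
    refine ⟨(hf.1.comp measurable_fst).mul (hg.1.comp measurable_snd), ?_⟩
    have := hf.2.mul_prod hg.2
    simpa only [mul_pow] using this
  have hint := hsq.mul hG.flip.toSqL
  have hint' : Integrable (Function.uncurry fun t s => f t * (G s t * g s))
      ((mT T).prod (mT T)) := by
    refine hint.congr (ae_of_all _ fun p => ?_)
    simp only [Function.uncurry]; ring
  unfold qf ip opKadj opK
  simp_rw [← integral_const_mul]
  rw [integral_integral_swap hint']
  congr 1; funext s; congr 1; funext t; ring

theorem ip_abs {T : ℝ} {f g : ℝ → ℝ} (hf : SqL (mT T) f) (hg : SqL (mT T) g) :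
    |ip T f g| ≤ Real.sqrt (∫ t in Icc (0:ℝ) T, (f t) ^ 2)
      * Real.sqrt (∫ t in Icc (0:ℝ) T, (g t) ^ 2) := hf.cs_sqrt hg

/-- operator norm facts -/
theorem timeOpNorm_mem {T : ℝ} {G : ℝ → ℝ → ℝ} (hG : IsL2Kernel T G) :
    0 ≤ timeOpNorm T G ∧ ∀ f : ℝ → ℝ, MemL2 T f →
    (∫ t in Icc (0:ℝ) T, (opK T G f t) ^ 2) ≤
      (timeOpNorm T G) ^ 2 * ∫ t in Icc (0:ℝ) T, (f t) ^ 2 := by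
  have hcl : IsClosed {x : ℝ | 0 ≤ x ∧ ∀ f : ℝ → ℝ, MemL2 T f →
    (∫ t in Icc (0:ℝ) T, (opK T G f t) ^ 2) ≤ x ^ 2 * ∫ t in Icc (0:ℝ) T, (f t) ^ 2} := by
    simp only [setOf_and, setOf_forall]
    refine (isClosed_le continuous_const continuous_id).inter ?_
    refine isClosed_iInter fun f => isClosed_iInter fun _ => ?_
    exact isClosed_le continuous_const (by fun_prop)
  exact hcl.csInf_mem ⟨Real.sqrt (hs T G), Real.sqrt_nonneg _, fun f hf => by
    rw [Real.sq_sqrt (hs_nonneg T G)]; exact opK_bound hG hf⟩ ⟨0, fun x hx => hx.1⟩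

theorem labelOpNorm_mem {U : ℝ → ℝ → ℝ} (hG : IsL2Kernel 1 U) :
    0 ≤ labelOpNorm U ∧ ∀ g : ℝ → ℝ, MemL2 1 g →
    (∫ u in Icc (0:ℝ) 1, (∫ v in Icc (0:ℝ) 1, U u v * g v) ^ 2)
      ≤ (labelOpNorm U) ^ 2 * ∫ u in Icc (0:ℝ) 1, (g u) ^ 2 :=
  timeOpNorm_mem hG

theorem qf_abs {T : ℝ} {G : ℝ → ℝ → ℝ} (hG : IsL2Kernel T G) {f g : ℝ → ℝ}
    (hf : SqL (mT T) f) (hg : SqL (mT T) g) :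
    |qf T G f g| ≤ timeOpNorm T G * (Real.sqrt (∫ t in Icc (0:ℝ) T, (f t) ^ 2)
      * Real.sqrt (∫ t in Icc (0:ℝ) T, (g t) ^ 2)) := by
  obtain ⟨h0, h1⟩ := timeOpNorm_mem hG
  have h2 := ip_abs hf (opK_sqL hG hg)
  have h3 : Real.sqrt (∫ t in Icc (0:ℝ) T, (opK T G g t) ^ 2) ≤
      timeOpNorm T G * Real.sqrt (∫ t in Icc (0:ℝ) T, (g t) ^ 2) := by
    have := Real.sqrt_le_sqrt (h1 g hg)
    rwa [Real.sqrt_mul (sq_nonneg _), Real.sqrt_sq h0] at this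
  calc |qf T G f g| ≤ _ := h2
    _ ≤ Real.sqrt (∫ t in Icc (0:ℝ) T, (f t) ^ 2) *
      (timeOpNorm T G * Real.sqrt (∫ t in Icc (0:ℝ) T, (g t) ^ 2)) := by gcongr
    _ = _ := by ring

/-! ### Parametrised families -/

section Param

variable {X : Type} [MeasurableSpace X] {ν : Measure X} [SFinite ν]

theorem ip_integrable {T : ℝ} {f g : X → ℝ → ℝ}
    (hf : SqL (ν.prod (mT T)) fun p => f p.1 p.2) (hg : SqL (ν.prod (mT T)) fun p => g p.1 p.2) :
    Integrable (fun x => ip T (f x) (g x)) ν :=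
  (hf.mul hg).integral_prod_left

theorem opK_param_meas {T : ℝ} {G : ℝ → ℝ → ℝ} (hG : IsL2Kernel T G) {g : X → ℝ → ℝ}
    (hg : Measurable fun p : X × ℝ => g p.1 p.2) :
    Measurable fun p : X × ℝ => opK T G (g p.1) p.2 := by
  unfold opK
  refine meas_int (f := fun (p : X × ℝ) s => G p.2 s * g p.1 s) ?_
  have h1 : Measurable fun q : (X × ℝ) × ℝ => G q.1.2 q.2 :=
    hG.1.comp ((measurable_snd.comp measurable_fst).prodMk measurable_snd)
  have h2 : Measurable fun q : (X × ℝ) × ℝ => g q.1.1 q.2 :=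
    hg.comp ((measurable_fst.comp measurable_fst).prodMk measurable_snd)
  exact h1.mul h2

theorem opK_param {T : ℝ} {G : ℝ → ℝ → ℝ} (hG : IsL2Kernel T G) {g : X → ℝ → ℝ}
    (hg : SqL (ν.prod (mT T)) fun p => g p.1 p.2) :
    SqL (ν.prod (mT T)) fun p => opK T G (g p.1) p.2 := by
  have hm := opK_param_meas hG hg.1
  refine ⟨hm, ?_⟩
  rw [integrable_prod_iff (hm.pow_const 2).aestronglyMeasurable]
  constructor
  · filter_upwards [hg.right] with x hx
    exact (opK_sqL hG hx).2
  · have h1 : Integrable (fun x => hs T G * ∫ s in Icc (0:ℝ) T, (g x s) ^ 2) ν :=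
      (hg.2.integral_prod_left).const_mul _
    refine h1.mono' ?_ ?_
    · exact (meas_int (f := fun x t => ‖opK T G (g x) t ^ 2‖)
        (hm.pow_const 2).norm).aestronglyMeasurable
    · filter_upwards [hg.right] with x hx
      have := opK_bound hG hx
      simp only [norm_pow, Real.norm_eq_abs, sq_abs]
      rw [abs_of_nonneg (sq_nn _)]
      exact this

theorem qf_integrable {T : ℝ} {G : ℝ → ℝ → ℝ} (hG : IsL2Kernel T G) {f g : X → ℝ → ℝ}
    (hf : SqL (ν.prod (mT T)) fun p => f p.1 p.2) (hg : SqL (ν.prod (mT T)) fun p => g p.1 p.2) :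
    Integrable (fun x => qf T G (f x) (g x)) ν :=
  ip_integrable hf (opK_param hG hg)

end Param

section Param2

variable {X : Type} [MeasurableSpace X] {ν : Measure X} [SFinite ν]

theorem qf_param_abs {T : ℝ} {G : ℝ → ℝ → ℝ} (hG : IsL2Kernel T G) {f g : X → ℝ → ℝ}
    (hf : SqL (ν.prod (mT T)) fun p => f p.1 p.2) (hg : SqL (ν.prod (mT T)) fun p => g p.1 p.2) :
    |∫ x, qf T G (f x) (g x) ∂ν| ≤ timeOpNorm T G *
      (Real.sqrt (∫ p, (f p.1 p.2) ^ 2 ∂(ν.prod (mT T))) *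
        Real.sqrt (∫ p, (g p.1 p.2) ^ 2 ∂(ν.prod (mT T)))) := by
  obtain ⟨h0, h1⟩ := timeOpNorm_mem hG
  have ho := opK_param hG hg
  have e1 : ∫ x, qf T G (f x) (g x) ∂ν
      = ∫ p, f p.1 p.2 * opK T G (g p.1) p.2 ∂(ν.prod (mT T)) :=
    (integral_prod _ (hf.mul ho)).symm
  have h2 := hf.cs_sqrt ho
  have h3 : ∫ p, (opK T G (g p.1) p.2) ^ 2 ∂(ν.prod (mT T)) ≤
      (timeOpNorm T G) ^ 2 * ∫ p, (g p.1 p.2) ^ 2 ∂(ν.prod (mT T)) := by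
    rw [integral_prod _ ho.2, integral_prod _ hg.2, ← integral_const_mul]
    refine integral_mono_ae ho.2.integral_prod_left (hg.2.integral_prod_left.const_mul _) ?_
    filter_upwards [hg.right] with x hx
    exact h1 _ hx
  have h4 : Real.sqrt (∫ p, (opK T G (g p.1) p.2) ^ 2 ∂(ν.prod (mT T))) ≤
      timeOpNorm T G * Real.sqrt (∫ p, (g p.1 p.2) ^ 2 ∂(ν.prod (mT T))) := by
    have := Real.sqrt_le_sqrt h3
    rwa [Real.sqrt_mul (sq_nonneg _), Real.sqrt_sq h0] at this
  rw [e1]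
  calc _ ≤ _ := h2
    _ ≤ Real.sqrt (∫ p, (f p.1 p.2) ^ 2 ∂(ν.prod (mT T))) *
      (timeOpNorm T G * Real.sqrt (∫ p, (g p.1 p.2) ^ 2 ∂(ν.prod (mT T)))) := by gcongr
    _ = _ := by ring

end Param2

/-! ### Label averages -/

/-- Label average of a profile. -/
def zf {Y : Type} (W : ℝ → ℝ → ℝ) (α : ℝ → Y → ℝ) (u : ℝ) (y : Y) : ℝ :=
  ∫ v in Icc (0:ℝ) 1, W u v * α v y

/-- Measurable kernel bounded by one. -/
def IsBdd (W : ℝ → ℝ → ℝ) : Prop :=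
  Measurable (Function.uncurry W) ∧ ∀ u v, |W u v| ≤ 1

theorem IsGraphon.bdd {W : ℝ → ℝ → ℝ} (h : IsGraphon W) : IsBdd W :=
  ⟨h.1, fun u v => by
    have := h.2.2 u v
    rw [abs_of_nonneg this.1]; exact this.2⟩

theorem IsGraphon.bdd_sub {W W' : ℝ → ℝ → ℝ} (h : IsGraphon W) (h' : IsGraphon W') :
    IsBdd (fun u v => W u v - W' u v) :=
  ⟨h.1.sub h'.1, fun u v => by
    have h1 := h.2.2 u v
    have h2 := h'.2.2 u v
    rw [abs_le]
    constructor <;> linarith [h1.1, h1.2, h2.1, h2.2]⟩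

theorem IsBdd.row {W : ℝ → ℝ → ℝ} (h : IsBdd W) (u : ℝ) : SqL (mT 1) (W u) := by
  have hm : Measurable (W u) := h.1.comp measurable_prodMk_left
  refine ⟨hm, ?_⟩
  refine Integrable.of_bound (hm.pow_const 2).aestronglyMeasurable 1 (ae_of_all _ fun v => ?_)
  rw [Real.norm_of_nonneg (sq_nonneg _), sq_le_one_iff_abs_le_one]
  exact h.2 u v

theorem IsBdd.kernel {W : ℝ → ℝ → ℝ} (h : IsBdd W) : IsL2Kernel 1 W := by
  refine ⟨h.1, ?_⟩
  refine Integrable.of_bound (h.1.pow_const 2).aestronglyMeasurable 1 (ae_of_all _ fun p => ?_)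
  rw [Real.norm_of_nonneg (sq_nonneg _), sq_le_one_iff_abs_le_one]
  exact h.2 _ _

theorem IsBdd.row_le {W : ℝ → ℝ → ℝ} (h : IsBdd W) (u : ℝ) :
    ∫ v in Icc (0:ℝ) 1, (W u v) ^ 2 ≤ 1 := by
  have : ∫ v in Icc (0:ℝ) 1, (W u v) ^ 2 ≤ ∫ v in Icc (0:ℝ) 1, (1:ℝ) := by
    refine integral_mono (h.row u).2 (integrable_const _) fun v => ?_
    exact (sq_le_one_iff_abs_le_one _).2 (h.2 u v)
  simpa using this

section Zf

variable {Y : Type} [MeasurableSpace Y] {κ : Measure Y} [SFinite κ]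

theorem zf_meas {W : ℝ → ℝ → ℝ} (h : IsBdd W) {α : ℝ → Y → ℝ}
    (hα : Measurable fun p : ℝ × Y => α p.1 p.2) :
    Measurable fun p : ℝ × Y => zf W α p.1 p.2 := by
  unfold zf
  refine meas_int (f := fun (p : ℝ × Y) v => W p.1 v * α v p.2) ?_
  have h1 : Measurable fun q : (ℝ × Y) × ℝ => W q.1.1 q.2 :=
    h.1.comp ((measurable_fst.comp measurable_fst).prodMk measurable_snd)
  have h2 : Measurable fun q : (ℝ × Y) × ℝ => α q.2 q.1.2 :=
    hα.comp (measurable_snd.prodMk (measurable_snd.comp measurable_fst))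
  exact h1.mul h2

theorem zf_bound {W : ℝ → ℝ → ℝ} (h : IsBdd W) {α : ℝ → Y → ℝ}
    (hα : SqL ((mT 1).prod κ) fun p => α p.1 p.2) :
    ∀ᵐ y ∂κ, SqL (mT 1) (fun v => α v y) ∧
      ∀ u, (zf W α u y) ^ 2 ≤ ∫ v in Icc (0:ℝ) 1, (α v y) ^ 2 := by
  filter_upwards [hα.swap.right] with y hy
  refine ⟨hy, fun u => ?_⟩
  have h1 := (h.row u).cs hy
  have h2 := h.row_le u
  have h3 := sq_nn (ν := mT 1) fun v => α v y
  exact h1.trans (mul_le_of_le_one_left h3 h2)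

theorem zf_row {W : ℝ → ℝ → ℝ} (h : IsBdd W) {α : ℝ → Y → ℝ}
    (hα : SqL ((mT 1).prod κ) fun p => α p.1 p.2) (u : ℝ) :
    SqL κ (zf W α u) := by
  have hm : Measurable (zf W α u) := (zf_meas h hα.1).comp measurable_prodMk_left
  refine ⟨hm, ?_⟩
  refine (hα.swap.2.integral_prod_left).mono' (hm.pow_const 2).aestronglyMeasurable ?_
  filter_upwards [zf_bound h hα] with y hy
  rw [Real.norm_of_nonneg (sq_nonneg _)]
  exact hy.2 u

theorem zf_sqL {W : ℝ → ℝ → ℝ} (h : IsBdd W) {α : ℝ → Y → ℝ}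
    (hα : SqL ((mT 1).prod κ) fun p => α p.1 p.2) :
    SqL ((mT 1).prod κ) fun p => zf W α p.1 p.2 := by
  have hm := zf_meas h hα.1
  refine ⟨hm, ?_⟩
  refine ((hα.swap.2.integral_prod_left).comp_snd (mT 1)).mono'
    (hm.pow_const 2).aestronglyMeasurable ?_
  have := (Measure.quasiMeasurePreserving_snd (μ := mT 1) (ν := κ)).ae (zf_bound h hα)
  filter_upwards [this] with p hp
  rw [Real.norm_of_nonneg (sq_nonneg _)]
  exact hp.2 p.1

theorem zf_opnorm {W : ℝ → ℝ → ℝ} (h : IsBdd W) {α : ℝ → Y → ℝ}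
    (hα : SqL ((mT 1).prod κ) fun p => α p.1 p.2) :
    ∫ p, (zf W α p.1 p.2) ^ 2 ∂((mT 1).prod κ) ≤
      (labelOpNorm W) ^ 2 * ∫ p, (α p.1 p.2) ^ 2 ∂((mT 1).prod κ) := by
  obtain ⟨h0, h1⟩ := labelOpNorm_mem h.kernel
  have hz := zf_sqL h hα
  rw [integral_prod_symm _ hz.2, integral_prod_symm _ hα.2, ← integral_const_mul]
  refine integral_mono_ae hz.2.integral_prod_right (hα.2.integral_prod_right.const_mul _) ?_
  filter_upwards [zf_bound h hα] with y hy
  exact h1 _ hy.1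

theorem zf_split {W W' : ℝ → ℝ → ℝ} (h : IsBdd W) (h' : IsBdd W') {α β : ℝ → Y → ℝ}
    (hα : SqL ((mT 1).prod κ) fun p => α p.1 p.2)
    (hβ : SqL ((mT 1).prod κ) fun p => β p.1 p.2) :
    ∀ᵐ y ∂κ, ∀ u, zf W α u y - zf W' β u y =
      zf W (fun v y => α v y - β v y) u y + zf (fun u v => W u v - W' u v) β u y := by
  filter_upwards [zf_bound h hα, zf_bound h hβ] with y h1 h2 u
  have i1 := (h.row u).mul h1.1
  have i2 := (h.row u).mul h2.1
  have i3 := (h'.row u).mul h2.1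
  unfold zf
  simp only [mul_sub, sub_mul]
  rw [integral_sub i1 i2, integral_sub i2 i3]
  ring

end Zf

theorem zf_ip {T : ℝ} {W : ℝ → ℝ → ℝ} (h : IsBdd W) {δ : ℝ → ℝ → ℝ}
    (hδ : SqL ((mT 1).prod (mT T)) fun p => δ p.1 p.2) {k : ℝ → ℝ} (hk : SqL (mT T) k) (u : ℝ) :
    ip T (zf W δ u) k = ∫ v in Icc (0:ℝ) 1, W u v * ip T (δ v) k := by
  have hk' : SqL ((mT 1).prod (mT T)) fun p => k p.2 :=
    ⟨hk.1.comp measurable_snd, hk.2.comp_snd (mT 1)⟩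
  have i1 : Integrable (fun p : ℝ × ℝ => W u p.1 * (δ p.1 p.2 * k p.2))
      ((mT 1).prod (mT T)) := by
    refine (hδ.mul hk').bdd_mul (c := 1) ?_ (ae_of_all _ fun p => h.2 u p.1)
    exact ((h.row u).1.comp measurable_fst).aestronglyMeasurable
  unfold ip zf
  simp_rw [← integral_const_mul, ← integral_mul_const]
  rw [integral_integral_swap (f := fun v t => W u v * (δ v t * k t)) i1]
  congr 1; funext t; congr 1; funext v; ring

theorem zf_sym {T : ℝ} {W : ℝ → ℝ → ℝ} (hW : IsGraphon W) {B : ℝ → ℝ → ℝ} (hB : IsL2Kernel T B)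
    {δ : ℝ → ℝ → ℝ} (hδ : SqL ((mT 1).prod (mT T)) fun p => δ p.1 p.2) :
    ∫ u in Icc (0:ℝ) 1, qf T B (zf W δ u) (δ u) = ∫ u in Icc (0:ℝ) 1, qf T B (δ u) (zf W δ u) := by
  have s2 : SqL (((mT 1).prod (mT 1)).prod (mT T)) fun p => δ p.1.2 p.2 := by
    have hm : Measurable fun p : (ℝ × ℝ) × ℝ => δ p.1.2 p.2 :=
      hδ.1.comp ((measurable_snd.comp measurable_fst).prodMk measurable_snd)
    refine ⟨hm, ?_⟩
    have := hδ.2.comp_snd (mT 1)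
    exact (measurePreserving_prodAssoc (mT 1) (mT 1) (mT T)).integrable_comp_of_integrable this
  have s1 : SqL (((mT 1).prod (mT 1)).prod (mT T)) fun p => δ p.1.1 p.2 := by
    have hm : Measurable fun p : (ℝ × ℝ) × ℝ => δ p.1.1 p.2 :=
      hδ.1.comp ((measurable_fst.comp measurable_fst).prodMk measurable_snd)
    refine ⟨hm, ?_⟩
    have hp : MeasurePreserving (Prod.map Prod.swap id)
        (((mT 1).prod (mT 1)).prod (mT T)) (((mT 1).prod (mT 1)).prod (mT T)) :=
      (Measure.measurePreserving_swap).prod (MeasurePreserving.id _)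
    exact hp.integrable_comp_of_integrable s2.2
  have i0 : Integrable (fun p : ℝ × ℝ => qf T B (δ p.2) (δ p.1)) ((mT 1).prod (mT 1)) :=
    qf_integrable hB (f := fun p : ℝ × ℝ => δ p.2) (g := fun p => δ p.1) s2 s1
  have i1 : Integrable (fun p : ℝ × ℝ => W p.1 p.2 * qf T B (δ p.2) (δ p.1))
      ((mT 1).prod (mT 1)) :=
    i0.bdd_mul (c := 1) hW.1.aestronglyMeasurable (ae_of_all _ fun p => hW.bdd.2 p.1 p.2)
  have e1 : ∫ u in Icc (0:ℝ) 1, qf T B (zf W δ u) (δ u) =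
      ∫ u in Icc (0:ℝ) 1, ∫ v in Icc (0:ℝ) 1, W u v * qf T B (δ v) (δ u) := by
    apply integral_congr_ae
    filter_upwards [hδ.right] with u hu
    exact zf_ip hW.bdd hδ (opK_sqL hB hu) u
  have e2 : ∫ u in Icc (0:ℝ) 1, qf T B (δ u) (zf W δ u) =
      ∫ u in Icc (0:ℝ) 1, ∫ v in Icc (0:ℝ) 1, W u v * qf T B (δ u) (δ v) := by
    apply integral_congr_ae
    filter_upwards [hδ.right] with u hu
    rw [← ip_opKadj hB (zf_row hW.bdd hδ u) hu]
    have := zf_ip hW.bdd hδ (opK_sqL hB.flip hu) u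
    refine Eq.trans this ?_
    apply integral_congr_ae
    filter_upwards [hδ.right] with v hv
    rw [← ip_opKadj hB hv hu]
    rfl
  rw [e1, e2, integral_integral_swap (f := fun u v => W u v * qf T B (δ v) (δ u)) i1]
  congr 1; funext u; congr 1; funext v
  rw [hW.2.1 u v]

/-! ### The deterministic core -/

/-- First order form. -/
def Df (T : ℝ) (A B : ℝ → ℝ → ℝ) (lam : ℝ) (f h z b : ℝ → ℝ) : ℝ :=
  qf T A h f + qf T A f h + 2 * lam * ip T f h + qf T B h z + qf T B z h - ip T b h

theorem Df_sub {T : ℝ} {A B : ℝ → ℝ → ℝ} (hA : IsL2Kernel T A) (hB : IsL2Kernel T B) (lam : ℝ)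
    {f1 f2 z1 z2 b1 b2 zd y : ℝ → ℝ}
    (hf1 : SqL (mT T) f1) (hf2 : SqL (mT T) f2) (hz2 : SqL (mT T) z2)
    (hb1 : SqL (mT T) b1) (hb2 : SqL (mT T) b2) (hzd : SqL (mT T) zd) (hy : SqL (mT T) y)
    (hz : ∀ᵐ t ∂(mT T), z1 t - z2 t = zd t + y t) :
    Df T A B lam f1 (fun t => f1 t - f2 t) z1 b1 - Df T A B lam f2 (fun t => f1 t - f2 t) z2 b2
      = 2 * (qf T A (fun t => f1 t - f2 t) (fun t => f1 t - f2 t)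
          + lam * ip T (fun t => f1 t - f2 t) (fun t => f1 t - f2 t)
          + qf T B (fun t => f1 t - f2 t) zd)
        + (qf T B zd (fun t => f1 t - f2 t) - qf T B (fun t => f1 t - f2 t) zd)
        + (qf T B (fun t => f1 t - f2 t) y + qf T B y (fun t => f1 t - f2 t))
        - ip T (fun t => b1 t - b2 t) (fun t => f1 t - f2 t) := by
  have hd := hf1.sub hf2
  set d := fun t => f1 t - f2 t with hdd
  have ed : d = fun t => f1 t + (-1) * f2 t := by funext t; simp [hdd]; ring
  have eb : (fun t => b1 t - b2 t) = fun t => b1 t + (-1) * b2 t := by funext t; ring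
  have ez : z1 =ᵐ[mT T] fun t => (fun t => z2 t + 1 * zd t) t + 1 * y t := by
    filter_upwards [hz] with t ht
    linarith
  have hz3 : SqL (mT T) (fun t => z2 t + 1 * zd t) := hz2.add (hzd.smul 1)
  have a1 : qf T A d d = qf T A d f1 + (-1) * qf T A d f2 := by
    conv_lhs => rw [show qf T A d d = qf T A d (fun t => f1 t + (-1) * f2 t) by rw [← ed]]
    exact qf_lin_right hA hf1 hf2 hd _
  have a2 : qf T A d d = qf T A f1 d + (-1) * qf T A f2 d := by
    conv_lhs => rw [show qf T A d d = qf T A (fun t => f1 t + (-1) * f2 t) d by rw [← ed]]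
    exact qf_lin_left hA hf1 hf2 hd _
  have a3 : ip T d d = ip T f1 d + (-1) * ip T f2 d := by
    conv_lhs => rw [show ip T d d = ip T (fun t => f1 t + (-1) * f2 t) d by rw [← ed]]
    exact ip_lin_left hf1 hf2 hd _
  have a4 : ip T (fun t => b1 t - b2 t) d = ip T b1 d + (-1) * ip T b2 d := by
    rw [eb]; exact ip_lin_left hb1 hb2 hd _
  have a5 : qf T B d z1 = qf T B d z2 + 1 * qf T B d zd + 1 * qf T B d y := by
    rw [← qf_lin_right hB hz2 hzd hd, ← qf_lin_right hB hz3 hy hd]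
    unfold qf; rw [opK_congr ez]
  have a6 : qf T B z1 d = qf T B z2 d + 1 * qf T B zd d + 1 * qf T B y d := by
    rw [← qf_lin_left hB hz2 hzd hd, ← qf_lin_left hB hz3 hy hd]
    unfold qf; exact ip_congr_left ez
  unfold Df
  rw [a4, a5, a6]
  linear_combination (-1) * a1 - a2 - 2 * lam * a3

theorem core {T : ℝ} {A B : ℝ → ℝ → ℝ} (hA : IsL2Kernel T A) (hB : IsL2Kernel T B) (lam : ℝ)
    {W W' : ℝ → ℝ → ℝ} (hW : IsGraphon W) (hW' : IsGraphon W') (cW : ℝ)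
    (hcoerc : ∀ g : ℝ → ℝ → ℝ, MemL2TI T g →
      cW * (∫ u in Icc (0:ℝ) 1, ∫ t in Icc (0:ℝ) T, (g t u) ^ 2) ≤
        ∫ u in Icc (0:ℝ) 1, ∫ t in Icc (0:ℝ) T,
          g t u * (lam * g t u + opK T A (fun s => g s u) t
            + opK T B (fun s => ∫ v in Icc (0:ℝ) 1, W u v * g s v) t))
    {α β b b' : ℝ → ℝ → ℝ}
    (hα : SqL ((mT 1).prod (mT T)) fun p => α p.1 p.2)
    (hβ : SqL ((mT 1).prod (mT T)) fun p => β p.1 p.2)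
    (hb : SqL ((mT 1).prod (mT T)) fun p => b p.1 p.2)
    (hb' : SqL ((mT 1).prod (mT T)) fun p => b' p.1 p.2) :
    2 * cW * ∫ p, (α p.1 p.2 - β p.1 p.2) ^ 2 ∂((mT 1).prod (mT T)) ≤
      timeOpNorm T B * labelOpNorm (fun u v => W u v - W' u v) *
        ((∫ p, (α p.1 p.2) ^ 2 ∂((mT 1).prod (mT T)))
          + 3 * ∫ p, (β p.1 p.2) ^ 2 ∂((mT 1).prod (mT T)))
      + (∫ p, (b p.1 p.2 - b' p.1 p.2) * (α p.1 p.2 - β p.1 p.2) ∂((mT 1).prod (mT T)))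
      + ∫ u in Icc (0:ℝ) 1,
          (Df T A B lam (α u) (fun t => α u t - β u t) (zf W α u) (b u)
            - Df T A B lam (β u) (fun t => α u t - β u t) (zf W' β u) (b' u)) := by
  have hU := hW.bdd_sub hW'
  have hd := hα.sub hβ
  have hbb := hb.sub hb'
  set δ : ℝ → ℝ → ℝ := fun u t => α u t - β u t with hδdef
  set U : ℝ → ℝ → ℝ := fun u v => W u v - W' u v with hUdef
  have hδ : SqL ((mT 1).prod (mT T)) fun p => δ p.1 p.2 := hd
  have hz : SqL ((mT 1).prod (mT T)) fun p => zf W δ p.1 p.2 := zf_sqL hW.bdd hδ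
  have hy : SqL ((mT 1).prod (mT T)) fun p => zf U β p.1 p.2 := zf_sqL hU hβ
  -- integrability in the label
  have i1 : Integrable (fun u => qf T A (δ u) (δ u)) (mT 1) := qf_integrable hA hδ hδ
  have i2 : Integrable (fun u => ip T (δ u) (δ u)) (mT 1) := ip_integrable hδ hδ
  have i3 : Integrable (fun u => qf T B (δ u) (zf W δ u)) (mT 1) := qf_integrable hB hδ hz
  have i4 : Integrable (fun u => qf T B (zf W δ u) (δ u)) (mT 1) := qf_integrable hB hz hδ
  have i5 : Integrable (fun u => qf T B (δ u) (zf U β u)) (mT 1) := qf_integrable hB hδ hy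
  have i6 : Integrable (fun u => qf T B (zf U β u) (δ u)) (mT 1) := qf_integrable hB hy hδ
  have i7 : Integrable (fun u => ip T (fun t => b u t - b' u t) (δ u)) (mT 1) :=
    ip_integrable (f := fun u t => b u t - b' u t) hbb hδ
  have j1 : Integrable (fun u => qf T A (δ u) (δ u) + lam * ip T (δ u) (δ u)
      + qf T B (δ u) (zf W δ u)) (mT 1) := (i1.add (i2.const_mul lam)).add i3
  have j2 : Integrable (fun u => qf T B (zf W δ u) (δ u) - qf T B (δ u) (zf W δ u)) (mT 1) :=
    i4.sub i3
  have j3 : Integrable (fun u => qf T B (δ u) (zf U β u) + qf T B (zf U β u) (δ u)) (mT 1) :=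
    i5.add i6
  have k1 : Integrable (fun u => 2 * (qf T A (δ u) (δ u) + lam * ip T (δ u) (δ u)
      + qf T B (δ u) (zf W δ u)) + (qf T B (zf W δ u) (δ u) - qf T B (δ u) (zf W δ u))) (mT 1) :=
    (j1.const_mul 2).add j2
  have k2 : Integrable (fun u => 2 * (qf T A (δ u) (δ u) + lam * ip T (δ u) (δ u)
      + qf T B (δ u) (zf W δ u)) + (qf T B (zf W δ u) (δ u) - qf T B (δ u) (zf W δ u))
      + (qf T B (δ u) (zf U β u) + qf T B (zf U β u) (δ u))) (mT 1) := k1.add j3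
  have eD : ∫ u in Icc (0:ℝ) 1,
      (Df T A B lam (α u) (fun t => α u t - β u t) (zf W α u) (b u)
        - Df T A B lam (β u) (fun t => α u t - β u t) (zf W' β u) (b' u)) =
      ∫ u in Icc (0:ℝ) 1, (2 * (qf T A (δ u) (δ u) + lam * ip T (δ u) (δ u)
      + qf T B (δ u) (zf W δ u)) + (qf T B (zf W δ u) (δ u) - qf T B (δ u) (zf W δ u))
      + (qf T B (δ u) (zf U β u) + qf T B (zf U β u) (δ u))
      - ip T (fun t => b u t - b' u t) (δ u)) := by
    apply integral_congr_ae
    filter_upwards [hα.right, hβ.right, hb.right, hb'.right] with u h1 h2 h3 h4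
    refine Df_sub hA hB lam h1 h2 (zf_row hW'.bdd hβ u) h3 h4
      (zf_row hW.bdd hδ u) (zf_row hU hβ u) ?_
    filter_upwards [zf_split hW.bdd hW'.bdd hα hβ] with t ht
    exact ht u
  have eib : ∫ u in Icc (0:ℝ) 1, ip T (fun t => b u t - b' u t) (δ u) =
      ∫ p, (b p.1 p.2 - b' p.1 p.2) * (α p.1 p.2 - β p.1 p.2) ∂((mT 1).prod (mT T)) :=
    (integral_prod _ (hbb.mul hd)).symm
  rw [eD, integral_sub k2 i7, integral_add k1 j3, integral_add (j1.const_mul 2) j2,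
    integral_const_mul, integral_sub i4 i3, integral_add i5 i6, zf_sym hW hB hδ, eib]
  -- coercivity
  have hco := hcoerc (fun t u => δ u t) hδ.swap
  have ec : ∫ u in Icc (0:ℝ) 1, ∫ t in Icc (0:ℝ) T,
          δ u t * (lam * δ u t + opK T A (fun s => δ u s) t
            + opK T B (fun s => ∫ v in Icc (0:ℝ) 1, W u v * δ v s) t) =
      ∫ u in Icc (0:ℝ) 1, (qf T A (δ u) (δ u) + lam * ip T (δ u) (δ u)
      + qf T B (δ u) (zf W δ u)) := by
    apply integral_congr_ae
    filter_upwards [hδ.right] with u hu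
    have m1 := hu.mul (opK_sqL hA hu)
    have m2 := (hu.mul hu).const_mul lam
    have m3 := hu.mul (opK_sqL hB (zf_row hW.bdd hδ u))
    have m12 : Integrable (fun t => δ u t * opK T A (δ u) t + lam * (δ u t * δ u t)) (mT T) :=
      m1.add m2
    unfold qf ip
    rw [← integral_const_mul, ← integral_add m1 m2, ← integral_add m12 m3]
    congr 1; funext t
    change δ u t * (lam * δ u t + opK T A (δ u) t + opK T B (zf W δ u) t) = _
    ring
  have en : ∫ u in Icc (0:ℝ) 1, ∫ t in Icc (0:ℝ) T, (δ u t) ^ 2 =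
      ∫ p, (α p.1 p.2 - β p.1 p.2) ^ 2 ∂((mT 1).prod (mT T)) :=
    (integral_prod _ hδ.2).symm
  rw [ec, en] at hco
  -- perturbation
  obtain ⟨nB0, -⟩ := timeOpNorm_mem hB
  obtain ⟨nU0, -⟩ := labelOpNorm_mem hU.kernel
  have p1 := (abs_le.1 (qf_param_abs hB hδ hy)).1
  have p2 := (abs_le.1 (qf_param_abs hB hy hδ)).1
  have p3 : Real.sqrt (∫ p, (zf U β p.1 p.2) ^ 2 ∂((mT 1).prod (mT T))) ≤
      labelOpNorm U * Real.sqrt (∫ p, (β p.1 p.2) ^ 2 ∂((mT 1).prod (mT T))) := by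
    have := Real.sqrt_le_sqrt (zf_opnorm hU hβ)
    rwa [Real.sqrt_mul (sq_nonneg _), Real.sqrt_sq nU0] at this
  have p4 : Real.sqrt (∫ p, (δ p.1 p.2) ^ 2 ∂((mT 1).prod (mT T))) ≤ _ := hα.minkowski hβ
  have q1 := Real.sq_sqrt (sq_nn (ν := (mT 1).prod (mT T)) fun p => α p.1 p.2)
  have q2 := Real.sq_sqrt (sq_nn (ν := (mT 1).prod (mT T)) fun p => β p.1 p.2)
  rw [← q1, ← q2]
  clear q1 q2
  have ra := Real.sqrt_nonneg (∫ p, (α p.1 p.2) ^ 2 ∂((mT 1).prod (mT T)))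
  have rb := Real.sqrt_nonneg (∫ p, (β p.1 p.2) ^ 2 ∂((mT 1).prod (mT T)))
  have rd := Real.sqrt_nonneg (∫ p, (δ p.1 p.2) ^ 2 ∂((mT 1).prod (mT T)))
  have ry := Real.sqrt_nonneg (∫ p, (zf U β p.1 p.2) ^ 2 ∂((mT 1).prod (mT T)))
  generalize Real.sqrt (∫ p, (α p.1 p.2) ^ 2 ∂((mT 1).prod (mT T))) = sa at *
  generalize Real.sqrt (∫ p, (β p.1 p.2) ^ 2 ∂((mT 1).prod (mT T))) = sb at *
  generalize Real.sqrt (∫ p, (δ p.1 p.2) ^ 2 ∂((mT 1).prod (mT T))) = sd at *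
  generalize Real.sqrt (∫ p, (zf U β p.1 p.2) ^ 2 ∂((mT 1).prod (mT T))) = sy at *
  have f1 : sd * sy ≤ (sa + sb) * (labelOpNorm U * sb) :=
    mul_le_mul p4 p3 ry (by positivity)
  have f2 : timeOpNorm T B * (sd * sy) ≤ timeOpNorm T B * ((sa + sb) * (labelOpNorm U * sb)) :=
    mul_le_mul_of_nonneg_left f1 nB0
  have f3 : 2 * ((sa + sb) * sb) ≤ sa ^ 2 + 3 * sb ^ 2 := by nlinarith [sq_nonneg (sa - sb)]
  have f4 := mul_le_mul_of_nonneg_left f3 (mul_nonneg nB0 nU0)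
  have f5 : timeOpNorm T B * (sy * sd) = timeOpNorm T B * (sd * sy) := by ring
  have f6 : 2 * (timeOpNorm T B * ((sa + sb) * (labelOpNorm U * sb))) =
    timeOpNorm T B * labelOpNorm U * (2 * ((sa + sb) * sb)) := by ring
  linarith

/-! ### First order condition -/

/-- Integrand of the objective. -/
def Jint (T : ℝ) (A B C : ℝ → ℝ → ℝ) (lam : ℝ) (f z b bs : ℝ → ℝ) (c : ℝ) : ℝ :=
  - ip T f (fun t => opK T A f t + lam * f t)
      - ip T f (fun t => opK T B z t + opKadj T B z t)
      - ip T z (opK T C z) + ip T b f + ip T bs z + c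

theorem Jint_eq {T : ℝ} {A B : ℝ → ℝ → ℝ} (hA : IsL2Kernel T A) (hB : IsL2Kernel T B)
    (C : ℝ → ℝ → ℝ) (lam : ℝ)
    {f z b bs : ℝ → ℝ} (c : ℝ) (hf : SqL (mT T) f) (hz : SqL (mT T) z) :
    Jint T A B C lam f z b bs c = -(qf T A f f + lam * ip T f f) - (qf T B f z + qf T B z f)
      - qf T C z z + ip T b f + ip T bs z + c := by
  have h1 := ip_lin_right (opK_sqL hA hf) hf hf lam
  have h2 := ip_lin_right (opK_sqL hB hz) (opK_sqL hB.flip hz) hf 1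
  have h3 : ip T f (opK T (fun t s => B s t) z) = qf T B z f := ip_opKadj hB hf hz
  simp only [one_mul] at h2
  have h4 : ip T f (fun t => opK T B z t + opKadj T B z t)
    = ip T f (opK T B z) + ip T f (opK T (fun t s => B s t) z) := h2
  unfold Jint
  rw [h1, h4, h3]
  rfl

theorem Jint_var {T : ℝ} {A B : ℝ → ℝ → ℝ} (hA : IsL2Kernel T A) (hB : IsL2Kernel T B)
    (C : ℝ → ℝ → ℝ) (lam : ℝ)
    {f h z b bs : ℝ → ℝ} (c : ℝ) (hf : SqL (mT T) f) (hh : SqL (mT T) h) (hz : SqL (mT T) z)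
    (hb : SqL (mT T) b) (ε : ℝ) :
    Jint T A B C lam (fun t => f t + ε * h t) z b bs c =
      Jint T A B C lam f z b bs c - ε * Df T A B lam f h z b
        - ε ^ 2 * (qf T A h h + lam * ip T h h) := by
  have hfh : SqL (mT T) (fun t => f t + ε * h t) := hf.add (hh.smul ε)
  rw [Jint_eq hA hB C lam c hfh hz, Jint_eq hA hB C lam c hf hz,
    qf_lin_left hA hf hh hfh, qf_lin_right hA hf hh hf, qf_lin_right hA hf hh hh,
    ip_lin_left hf hh hfh, ip_lin_right hf hh hf, ip_lin_right hf hh hh,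
    qf_lin_left hB hf hh hz, qf_lin_right hB hf hh hz, ip_lin_right hf hh hb, ip_comm T h f]
  unfold Df
  ring

section FOC

variable {X : Type} [MeasurableSpace X] {ν : Measure X} [SFinite ν]

theorem Df_integrable {T : ℝ} {A B : ℝ → ℝ → ℝ} (hA : IsL2Kernel T A) (hB : IsL2Kernel T B)
    (lam : ℝ) {f h z b : X → ℝ → ℝ}
    (hf : SqL (ν.prod (mT T)) fun p => f p.1 p.2)
    (hh : SqL (ν.prod (mT T)) fun p => h p.1 p.2)
    (hz : SqL (ν.prod (mT T)) fun p => z p.1 p.2)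
    (hb : SqL (ν.prod (mT T)) fun p => b p.1 p.2) :
    Integrable (fun x => Df T A B lam (f x) (h x) (z x) (b x)) ν := by
  unfold Df
  exact (((((qf_integrable hA hh hf).add (qf_integrable hA hf hh)).add
    ((ip_integrable hf hh).const_mul _)).add (qf_integrable hB hh hz)).add
    (qf_integrable hB hz hh)).sub (ip_integrable hb hh)

theorem foc {T : ℝ} {A B C : ℝ → ℝ → ℝ} (hA : IsL2Kernel T A) (hB : IsL2Kernel T B)
    (hC : IsL2Kernel T C) (lam : ℝ) {f h z b bs : X → ℝ → ℝ} {c : X → ℝ}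
    (hf : SqL (ν.prod (mT T)) fun p => f p.1 p.2)
    (hh : SqL (ν.prod (mT T)) fun p => h p.1 p.2)
    (hz : SqL (ν.prod (mT T)) fun p => z p.1 p.2)
    (hb : SqL (ν.prod (mT T)) fun p => b p.1 p.2)
    (hbs : SqL (ν.prod (mT T)) fun p => bs p.1 p.2)
    (hc : Integrable c ν)
    (hmax : ∀ ε : ℝ, ∫ x, Jint T A B C lam (fun t => f x t + ε * h x t) (z x) (b x) (bs x) (c x) ∂ν
      ≤ ∫ x, Jint T A B C lam (f x) (z x) (b x) (bs x) (c x) ∂ν) :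
    ∫ x, Df T A B lam (f x) (h x) (z x) (b x) ∂ν = 0 := by
  have iD := Df_integrable hA hB lam hf hh hz hb
  have iS : Integrable (fun x => qf T A (h x) (h x) + lam * ip T (h x) (h x)) ν :=
    (qf_integrable hA hh hh).add ((ip_integrable hh hh).const_mul lam)
  have iJ : Integrable (fun x => Jint T A B C lam (f x) (z x) (b x) (bs x) (c x)) ν := by
    have i1 : Integrable (fun x => -(qf T A (f x) (f x) + lam * ip T (f x) (f x))
        - (qf T B (f x) (z x) + qf T B (z x) (f x))
      - qf T C (z x) (z x) + ip T (b x) (f x) + ip T (bs x) (z x) + c x) ν :=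
      (((((((qf_integrable hA hf hf).add ((ip_integrable hf hf).const_mul lam)).neg).sub
        ((qf_integrable hB hf hz).add (qf_integrable hB hz hf))).sub
        (qf_integrable hC hz hz)).add (ip_integrable hb hf)).add (ip_integrable hbs hz)).add hc
    refine i1.congr ?_
    filter_upwards [hf.right, hz.right] with x h1 h2
    exact (Jint_eq hA hB C lam (c x) h1 h2).symm
  have key : ∀ ε : ℝ, 0 ≤ ε * (∫ x, Df T A B lam (f x) (h x) (z x) (b x) ∂ν)
      + ε ^ 2 * ∫ x, (qf T A (h x) (h x) + lam * ip T (h x) (h x)) ∂ν := by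
    intro ε
    have h1 := hmax ε
    have e1 : ∫ x, Jint T A B C lam (fun t => f x t + ε * h x t) (z x) (b x) (bs x) (c x) ∂ν
        = ∫ x, (Jint T A B C lam (f x) (z x) (b x) (bs x) (c x)
          - ε * Df T A B lam (f x) (h x) (z x) (b x)
          - ε ^ 2 * (qf T A (h x) (h x) + lam * ip T (h x) (h x))) ∂ν := by
      apply integral_congr_ae
      filter_upwards [hf.right, hh.right, hz.right, hb.right] with x a1 a2 a3 a4
      exact Jint_var hA hB C lam (c x) a1 a2 a3 a4 ε
    have i2 : Integrable (fun x => Jint T A B C lam (f x) (z x) (b x) (bs x) (c x)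
          - ε * Df T A B lam (f x) (h x) (z x) (b x)) ν := iJ.sub (iD.const_mul ε)
    rw [e1, integral_sub i2 (iS.const_mul _), integral_sub iJ (iD.const_mul ε),
      integral_const_mul, integral_const_mul] at h1
    linarith
  generalize ∫ x, Df T A B lam (f x) (h x) (z x) (b x) ∂ν = D at *
  generalize ∫ x, (qf T A (h x) (h x) + lam * ip T (h x) (h x)) ∂ν = S at *
  have k := discrim_le_zero (a := S) (b := D) (c := 0) (fun x => by
    have := key x; linarith [sq x])
  unfold discrim at k
  nlinarith [sq_nonneg D]

end FOC

/-! ### Reordering of the product space -/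

section Reorder

variable {Ω : Type} [MeasurableSpace Ω] {P : Measure Ω} [SFinite P]

theorem reorder_mp (T : ℝ) : MeasurePreserving (fun q : Ω × ℝ × ℝ => (q.2.1, q.2.2, q.1))
    (P.prod ((mT 1).prod (mT T))) ((mT 1).prod ((mT T).prod P)) :=
  (measurePreserving_prodAssoc (mT 1) (mT T) P).comp
    (Measure.measurePreserving_swap (μ := P) (ν := (mT 1).prod (mT T)))

theorem SqL.reorder {T : ℝ} {f : ℝ × ℝ × Ω → ℝ} (hf : SqL ((mT 1).prod ((mT T).prod P)) f) :
    SqL (P.prod ((mT 1).prod (mT T))) (fun q => f (q.2.1, q.2.2, q.1)) :=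
  ⟨hf.1.comp (reorder_mp (P := P) T).measurable,
    (reorder_mp (P := P) T).integrable_comp_of_integrable hf.2⟩

theorem SqL.reorder2 {T : ℝ} {f : ℝ × ℝ × Ω → ℝ} (hf : SqL ((mT 1).prod ((mT T).prod P)) f) :
    SqL ((P.prod (mT 1)).prod (mT T)) (fun q => f (q.1.2, q.2, q.1.1)) :=
  ⟨hf.reorder.1.comp (measurePreserving_prodAssoc P (mT 1) (mT T)).measurable,
    (measurePreserving_prodAssoc P (mT 1) (mT T)).integrable_comp_of_integrable hf.reorder.2⟩

theorem iter_int {T : ℝ} {g : Ω × ℝ × ℝ → ℝ} (hg : SqL (P.prod ((mT 1).prod (mT T))) g) :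
    ∫ ω, (∫ u in Icc (0:ℝ) 1, ∫ t in Icc (0:ℝ) T, (g (ω, u, t)) ^ 2) ∂P =
      ∫ q, (g q) ^ 2 ∂(P.prod ((mT 1).prod (mT T))) := by
  rw [integral_prod _ hg.2]
  apply integral_congr_ae
  filter_upwards [hg.right] with ω hω
  exact (integral_prod _ hω.2).symm

end Reorder

theorem nash_foc {Ω : Type} {mΩ : MeasurableSpace Ω} (P : Measure Ω) [IsProbabilityMeasure P]
    (F : Filtration ℝ mΩ) (T : ℝ) {A B C : ℝ → ℝ → ℝ}
    (hA : IsL2Kernel T A) (hB : IsL2Kernel T B) (hC : IsL2Kernel T C)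
    (lam : ℝ) {W : ℝ → ℝ → ℝ} (hW : IsGraphon W) {b : ℝ → ℝ → Ω → ℝ}
    (hb : SqL ((mT 1).prod ((mT T).prod P)) (fun q : ℝ × ℝ × Ω => b q.1 q.2.1 q.2.2))
    {bstar : ℝ → Ω → ℝ} (hbstar : ProgMeasurable F bstar ∧ SqInt T P bstar)
    {c : ℝ → Ω → ℝ} (hc : ∀ u, Integrable (c u) P)
    {α h : ℝ → ℝ → Ω → ℝ}
    (hα : IsGraphonNash T F P A B C lam W b bstar c α)
    (hh : SqL ((mT 1).prod ((mT T).prod P)) (fun q : ℝ × ℝ × Ω => h q.1 q.2.1 q.2.2))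
    (hhp : ∀ u ∈ Icc (0:ℝ) 1, ProgMeasurable F (h u)) :
    ∀ᵐ u ∂(mT 1), ∫ ω, Df T A B lam (fun t => α u t ω) (fun t => h u t ω)
      (zf W (fun v t => α v t ω) u) (fun t => b u t ω) ∂P = 0 := by
  obtain ⟨⟨ham, hap, -, hai⟩, hmax⟩ := hα
  have ha : SqL ((mT 1).prod ((mT T).prod P)) (fun q : ℝ × ℝ × Ω => α q.1 q.2.1 q.2.2) :=
    ⟨ham, hai⟩
  -- a jointly measurable version of the common noise
  set bs : Ω → ℝ → ℝ := fun ω t => bstar (min t T) ω with hbs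
  have hbsm : Measurable fun p : Ω × ℝ => bs p.1 p.2 := by
    have h1 : Measurable[Subtype.instMeasurableSpace.prod (F T)]
      (fun p : Set.Iic T × Ω => bstar p.1 p.2) := (hbstar.1 T).measurable
    have h2 : Measurable (fun p : Set.Iic T × Ω => bstar p.1 p.2) :=
      h1.mono (sup_le_sup le_rfl (MeasurableSpace.comap_mono (F.le T))) le_rfl
    have h3 : Measurable fun p : Ω × ℝ => ((⟨min p.2 T, mem_Iic.2 (min_le_right _ _)⟩ : Set.Iic T), p.1) :=
      ((measurable_snd.min measurable_const).subtype_mk).prodMk measurable_fst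
    exact h2.comp h3
  have hbseq : ∀ ω, ∀ t ∈ Icc (0:ℝ) T, bstar t ω = bs ω t := by
    intro ω t ht
    simp only [hbs, min_eq_left ht.2]
  have hbsS : SqL (P.prod (mT T)) fun p => bs p.1 p.2 := by
    refine ⟨hbsm, ?_⟩
    have h1 := Integrable.swap hbstar.2
    refine h1.congr ?_
    have : ∀ᵐ t ∂(mT T), t ∈ Icc (0:ℝ) T := ae_restrict_mem measurableSet_Icc
    have := (Measure.quasiMeasurePreserving_snd (μ := P) (ν := mT T)).ae this
    filter_upwards [this] with p hp
    simp only [Function.comp, Prod.fst_swap, Prod.snd_swap]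
    rw [hbseq _ _ hp]
  have hJ : ∀ (u : ℝ) (γ : ℝ → ℝ → Ω → ℝ), Jgr T P A B C lam W b bstar c u γ =
      ∫ ω, Jint T A B C lam (fun t => γ u t ω) (zf W (fun v t => γ v t ω) u)
        (fun t => b u t ω) (bs ω) (c u ω) ∂P := by
    intro u γ
    have : ∀ ω, ip T (fun t => bstar t ω) (zf W (fun v t => γ v t ω) u) =
        ip T (bs ω) (zf W (fun v t => γ v t ω) u) := fun ω =>
      setIntegral_congr_fun measurableSet_Icc fun t ht => by
        simp only [hbseq ω t ht]
    unfold Jint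
    simp_rw [← this]
    rfl
  have hmem : ∀ᵐ u ∂(mT 1), u ∈ Icc (0:ℝ) 1 := ae_restrict_mem measurableSet_Icc
  filter_upwards [hmax, ha.right, hh.right, hb.right, hmem] with u hu hau hhu hbu hmu
  have hz : SqL ((mT T).prod P) (zf W (fun v (y : ℝ × Ω) => α v y.1 y.2) u) :=
    zf_row hW.bdd ha u
  refine foc hA hB hC lam (f := fun ω t => α u t ω) (h := fun ω t => h u t ω)
    (z := fun ω => zf W (fun v t => α v t ω) u) (b := fun ω t => b u t ω) (bs := bs)
    (c := c u) hau.swap hhu.swap hz.swap hbu.swap hbsS (hc u) ?_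
  intro ε
  have hp : ProgMeasurable F (fun t ω => α u t ω + ε * h u t ω) := by
    intro i
    exact (hap u hmu i).add ((hhp u hmu i).const_mul ε)
  have hs : SqL ((mT T).prod P) (fun p : ℝ × Ω => α u p.1 p.2 + ε * h u p.1 p.2) :=
    hau.add (hhu.smul ε)
  have := hu (fun t ω => α u t ω + ε * h u t ω) hp hs.2
  rw [hJ, hJ] at this
  have ez : ∀ ω, zf W (fun v t => Function.update α u (fun t ω => α u t ω + ε * h u t ω) v t ω) u
      = zf W (fun v t => α v t ω) u := by
    intro ω
    funext t
    apply integral_congr_ae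
    have hne : ∀ᵐ v ∂(mT 1), v ≠ u := by
      refine ae_restrict_of_ae ?_
      simp [ae_iff]
    filter_upwards [hne] with v hv
    rw [Function.update_of_ne hv]
  simp only [ez, Function.update_self] at this
  exact this
/-- Stability of graphon game Nash equilibria with respect to
perturbations of the graphon and of the noise. -/
theorem graphon_game_continuity
    {Ω : Type} {mΩ : MeasurableSpace Ω} (P : Measure Ω) [IsProbabilityMeasure P]
    (F : Filtration ℝ mΩ) (T : ℝ) (hT : 0 < T)
    (Atil Btil Ctil : ℝ → ℝ → ℝ)
    (hA : IsVolterraKernel T Atil) (hBk : IsVolterraKernel T Btil)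
    (hCk : IsVolterraKernel T Ctil)
    (hsup : ∃ Cs : ℝ, ∀ t ∈ Icc (0:ℝ) T,
      (∫ s in Icc (0:ℝ) T, ((Atil t s) ^ 2 + (Btil t s) ^ 2)) ≤ Cs ∧
        (∫ s in Icc (0:ℝ) T, ((Atil s t) ^ 2 + (Btil s t) ^ 2)) ≤ Cs)
    (lam : ℝ) (hlam : 0 < lam)
    (W : ℝ → ℝ → ℝ) (hW : IsGraphon W)
    (b : ℝ → ℝ → Ω → ℝ)
    (hbmeas : Measurable fun q : ℝ × ℝ × Ω => b q.1 q.2.1 q.2.2)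
    (hbL2 : Integrable (fun q : ℝ × ℝ × Ω => (b q.1 q.2.1 q.2.2) ^ 2)
      ((volume.restrict (Icc (0:ℝ) 1)).prod ((volume.restrict (Icc (0:ℝ) T)).prod P)))
    (hbprog : ∀ᵐ u ∂(volume.restrict (Icc (0:ℝ) 1)), ProgMeasurable F (b u))
    (bstar : ℝ → Ω → ℝ) (hbstar : ProgMeasurable F bstar ∧ SqInt T P bstar)
    (c : ℝ → Ω → ℝ) (hc : ∀ u, Integrable (c u) P ∧ Measurable[F T] (c u))
    -- Assumption (G4)
    (hApos : ∀ f : ℝ → ℝ, MemL2 T f → 0 ≤ ip T f (opK T Atil f))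
    (cW : ℝ) (hcW : 0 < cW)
    (hcoerc : ∀ g : ℝ → ℝ → ℝ, MemL2TI T g →
      cW * (∫ u in Icc (0:ℝ) 1, ∫ t in Icc (0:ℝ) T, (g t u) ^ 2) ≤
        ∫ u in Icc (0:ℝ) 1, ∫ t in Icc (0:ℝ) T,
          g t u * (lam * g t u + opK T Atil (fun s => g s u) t
            + opK T Btil (fun s => ∫ v in Icc (0:ℝ) 1, W u v * g s v) t))
    (αhat : ℝ → ℝ → Ω → ℝ)
    (hαhat : IsGraphonNash T F P Atil Btil Ctil lam W b bstar c αhat)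
    (W' : ℝ → ℝ → ℝ) (hW' : IsGraphon W')
    (b' : ℝ → ℝ → Ω → ℝ)
    (hb'meas : Measurable fun q : ℝ × ℝ × Ω => b' q.1 q.2.1 q.2.2)
    (hb'L2 : Integrable (fun q : ℝ × ℝ × Ω => (b' q.1 q.2.1 q.2.2) ^ 2)
      ((volume.restrict (Icc (0:ℝ) 1)).prod ((volume.restrict (Icc (0:ℝ) T)).prod P)))
    (hb'prog : ∀ᵐ u ∂(volume.restrict (Icc (0:ℝ) 1)), ProgMeasurable F (b' u))
    (βhat : ℝ → ℝ → Ω → ℝ)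
    (hβhat : IsGraphonNash T F P Atil Btil Ctil lam W' b' bstar c βhat) :
    (∫ ω, (∫ u in Icc (0:ℝ) 1, ∫ t in Icc (0:ℝ) T,
        (αhat u t ω - βhat u t ω) ^ 2) ∂P) ≤
      (1 / (2 * cW)) * timeOpNorm T Btil
          * labelOpNorm (fun u v => W u v - W' u v)
          * ((∫ ω, (∫ u in Icc (0:ℝ) 1, ∫ t in Icc (0:ℝ) T, (αhat u t ω) ^ 2) ∂P)
            + 3 * ∫ ω, (∫ u in Icc (0:ℝ) 1, ∫ t in Icc (0:ℝ) T, (βhat u t ω) ^ 2) ∂P)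
        + (1 / (2 * cW))
          * Real.sqrt (∫ ω, (∫ u in Icc (0:ℝ) 1, ∫ t in Icc (0:ℝ) T,
              (b u t ω - b' u t ω) ^ 2) ∂P)
          * (Real.sqrt (∫ ω, (∫ u in Icc (0:ℝ) 1, ∫ t in Icc (0:ℝ) T,
                (αhat u t ω) ^ 2) ∂P)
            + Real.sqrt (∫ ω, (∫ u in Icc (0:ℝ) 1, ∫ t in Icc (0:ℝ) T,
                (βhat u t ω) ^ 2) ∂P)) := by
  have hA' := hA.1
  have hB' := hBk.1
  have sb : SqL ((mT 1).prod ((mT T).prod P)) (fun q : ℝ × ℝ × Ω => b q.1 q.2.1 q.2.2) :=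
    ⟨hbmeas, hbL2⟩
  have sb' : SqL ((mT 1).prod ((mT T).prod P)) (fun q : ℝ × ℝ × Ω => b' q.1 q.2.1 q.2.2) :=
    ⟨hb'meas, hb'L2⟩
  have sa : SqL ((mT 1).prod ((mT T).prod P)) (fun q : ℝ × ℝ × Ω => αhat q.1 q.2.1 q.2.2) :=
    ⟨hαhat.1.1, hαhat.1.2.2.2⟩
  have sβ : SqL ((mT 1).prod ((mT T).prod P)) (fun q : ℝ × ℝ × Ω => βhat q.1 q.2.1 q.2.2) :=
    ⟨hβhat.1.1, hβhat.1.2.2.2⟩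
  have sd := sa.sub sβ
  have sbb := sb.sub sb'
  have hdp : ∀ u ∈ Icc (0:ℝ) 1, ProgMeasurable F (fun t ω => αhat u t ω - βhat u t ω) :=
    fun u hu i => (hαhat.1.2.1 u hu i).sub (hβhat.1.2.1 u hu i)
  have foc1 := nash_foc P F T hA' hB' hCk.1 lam hW sb hbstar (fun u => (hc u).1) hαhat
    (h := fun u t ω => αhat u t ω - βhat u t ω) sd hdp
  have foc2 := nash_foc P F T hA' hB' hCk.1 lam hW' sb' hbstar (fun u => (hc u).1) hβhat
    (h := fun u t ω => αhat u t ω - βhat u t ω) sd hdp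
  have sz : SqL ((mT 1).prod ((mT T).prod P))
      (fun q : ℝ × ℝ × Ω => zf W (fun v (y : ℝ × Ω) => αhat v y.1 y.2) q.1 q.2) :=
    zf_sqL hW.bdd sa
  have sz' : SqL ((mT 1).prod ((mT T).prod P))
      (fun q : ℝ × ℝ × Ω => zf W' (fun v (y : ℝ × Ω) => βhat v y.1 y.2) q.1 q.2) :=
    zf_sqL hW'.bdd sβ
  have iD1 : Integrable (fun x : Ω × ℝ => Df T Atil Btil lam (fun t => αhat x.2 t x.1)
      (fun t => αhat x.2 t x.1 - βhat x.2 t x.1) (zf W (fun v t => αhat v t x.1) x.2)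
      (fun t => b x.2 t x.1)) (P.prod (mT 1)) :=
    Df_integrable hA' hB' lam (f := fun (x : Ω × ℝ) t => αhat x.2 t x.1)
      (h := fun x t => αhat x.2 t x.1 - βhat x.2 t x.1)
      (z := fun x => zf W (fun v t => αhat v t x.1) x.2)
      (b := fun x t => b x.2 t x.1) sa.reorder2 sd.reorder2 sz.reorder2 sb.reorder2
  have iD2 : Integrable (fun x : Ω × ℝ => Df T Atil Btil lam (fun t => βhat x.2 t x.1)
      (fun t => αhat x.2 t x.1 - βhat x.2 t x.1) (zf W' (fun v t => βhat v t x.1) x.2)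
      (fun t => b' x.2 t x.1)) (P.prod (mT 1)) :=
    Df_integrable hA' hB' lam (f := fun (x : Ω × ℝ) t => βhat x.2 t x.1)
      (h := fun x t => αhat x.2 t x.1 - βhat x.2 t x.1)
      (z := fun x => zf W' (fun v t => βhat v t x.1) x.2)
      (b := fun x t => b' x.2 t x.1) sβ.reorder2 sd.reorder2 sz'.reorder2 sb'.reorder2
  have iD := iD1.sub iD2
  -- the first order terms vanish in expectation
  have eR : ∫ ω, (∫ u in Icc (0:ℝ) 1,
      (Df T Atil Btil lam (fun t => αhat u t ω) (fun t => αhat u t ω - βhat u t ω)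
        (zf W (fun v t => αhat v t ω) u) (fun t => b u t ω)
      - Df T Atil Btil lam (fun t => βhat u t ω) (fun t => αhat u t ω - βhat u t ω)
        (zf W' (fun v t => βhat v t ω) u) (fun t => b' u t ω))) ∂P = 0 := by
    have e1 : ∀ᵐ u ∂(mT 1), ∫ ω,
      (Df T Atil Btil lam (fun t => αhat u t ω) (fun t => αhat u t ω - βhat u t ω)
        (zf W (fun v t => αhat v t ω) u) (fun t => b u t ω)
      - Df T Atil Btil lam (fun t => βhat u t ω) (fun t => αhat u t ω - βhat u t ω)
        (zf W' (fun v t => βhat v t ω) u) (fun t => b' u t ω)) ∂P = 0 := by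
      filter_upwards [foc1, foc2, iD1.prod_left_ae, iD2.prod_left_ae] with u h1 h2 h3 h4
      rw [integral_sub h3 h4, h1, h2, sub_zero]
    rw [integral_integral_swap iD, integral_congr_ae e1, integral_zero]
  have ia := sa.reorder.2.integral_prod_left
  have iβ := sβ.reorder.2.integral_prod_left
  have id := sd.reorder.2.integral_prod_left
  have ibd := (sbb.reorder.mul sd.reorder).integral_prod_left
  have iR := iD.integral_prod_left
  have i1 := (ia.add (iβ.const_mul 3)).const_mul
    (timeOpNorm T Btil * labelOpNorm (fun u v => W u v - W' u v))
  have hE := integral_mono_ae (id.const_mul (2 * cW)) ((i1.add ibd).add iR) (by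
    filter_upwards [sa.reorder.right, sβ.reorder.right, sb.reorder.right, sb'.reorder.right]
      with ω h1 h2 h3 h4
    exact core hA' hB' lam hW hW' cW hcoerc (α := fun u t => αhat u t ω)
      (β := fun u t => βhat u t ω) (b := fun u t => b u t ω) (b' := fun u t => b' u t ω)
      h1 h2 h3 h4)
  have i2 := i1.add ibd
  rw [integral_add' i2 iR, integral_add' i1 ibd, integral_const_mul, integral_const_mul,
    integral_add' ia (iβ.const_mul 3), integral_const_mul] at hE
  have eR' := eR
  simp only [Pi.sub_apply] at hE
  rw [eR, ← integral_prod _ sa.reorder.2, ← integral_prod _ sβ.reorder.2,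
    ← integral_prod _ sd.reorder.2, ← integral_prod _ (sbb.reorder.mul sd.reorder)] at hE
  have ea := iter_int sa.reorder
  have eβ := iter_int sβ.reorder
  have ed := iter_int sd.reorder
  have eb := iter_int sbb.reorder
  simp only at ea eβ ed eb
  rw [ea, eβ, ed, eb]
  have hcs := (le_abs_self _).trans (sbb.reorder.cs_sqrt sd.reorder)
  have hmk := sa.reorder.minkowski sβ.reorder
  have hfin := hcs.trans (mul_le_mul_of_nonneg_left hmk (Real.sqrt_nonneg _))
  have hc0 : 0 < 2 * cW := by linarith
  have hE2 := hE.trans (add_le_add (add_le_add le_rfl hfin) le_rfl)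
  rw [mul_assoc (1 / (2 * cW)), mul_assoc (1 / (2 * cW)), mul_assoc (1 / (2 * cW)),
    ← mul_add, one_div, ← div_eq_inv_mul, le_div_iff₀ hc0]
  linarith
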